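/- Let G be a finite group, let A_1, ..., A_n be finite subsets of G and let H be a subgroup of G such that |G| = |A_1|⋯|A_n|·|H|, G = A_1⋯A_n·H, each subset A_i admits a minimal logarithmic signature (as a subset of G), and H admits a minimal logarithmic signature. Then G admits a minimal logarithmic signature. -/

import Mathlib

/-- The product map of a sequence of blocks: `(a₁, …, aₛ) ↦ a₁ ⋯ aₛ`. -/
def lsProd {G : Type*} [Group G] {s : ℕ} (A : Fin s → Finset G)
    (a : ∀ i, (A i : Finset G)) : G :=
  (List.ofFn fun i => ((a i : G))).prod

/-- The length of a sequence of blocks: the sum of their cardinalities. -/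
def lsLength {G : Type*} [Group G] {s : ℕ} (A : Fin s → Finset G) : ℕ :=
  ∑ i, (A i).card

/-- The minimal possible length `Σ aⱼ pⱼ` for a set of size `n = ∏ pⱼ^{aⱼ}`. -/
def lsTarget (n : ℕ) : ℕ :=
  n.factorization.sum fun p a => a * p

/-- `A` is a logarithmic signature for the group `G`: the product map is a bijection. -/
def IsLS {G : Type*} [Group G] {s : ℕ} (A : Fin s → Finset G) : Prop :=
  Function.Bijective (lsProd A)

/-- `B` is a logarithmic signature for the finite subset `S` of `G`:
the product map is injective with image exactly `S`. -/
def IsLSFor {G : Type*} [Group G] (S : Finset G) {t : ℕ} (B : Fin t → Finset G) : Prop :=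
  Function.Injective (lsProd B) ∧ ∀ g : G, g ∈ S ↔ ∃ b, lsProd B b = g

/-- The group `G` admits a minimal logarithmic signature. -/
def HasMLS (G : Type*) [Group G] : Prop :=
  ∃ (s : ℕ) (A : Fin s → Finset G), IsLS A ∧ lsLength A = lsTarget (Nat.card G)

/-- The finite subset `S` of `G` admits a minimal logarithmic signature. -/
def HasMLSFor {G : Type*} [Group G] (S : Finset G) : Prop :=
  ∃ (t : ℕ) (B : Fin t → Finset G), IsLSFor S B ∧ lsLength B = lsTarget S.card

open scoped Pointwise

lemma lsTarget_one : lsTarget 1 = 0 := by simp [lsTarget]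

lemma lsTarget_mul {m n : ℕ} (hm : m ≠ 0) (hn : n ≠ 0) :
    lsTarget (m * n) = lsTarget m + lsTarget n := by
  unfold lsTarget
  rw [Nat.factorization_mul hm hn]
  exact Finsupp.sum_add_index' (fun p => by simp) fun p a b => by ring

lemma lsTarget_list_prod {l : List ℕ} (hl : ∀ m ∈ l, m ≠ 0) :
    lsTarget l.prod = (l.map lsTarget).sum := by
  induction l with
  | nil => simpa using lsTarget_one
  | cons m l ih =>
    have hl' : ∀ k ∈ l, k ≠ 0 := fun k hk => hl k (by simp [hk])
    rw [List.prod_cons, lsTarget_mul (hl m (by simp)) (List.prod_ne_zero fun h => hl' 0 h rfl),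
      ih hl', List.map_cons, List.sum_cons]

/-- A logarithmic signature for `S` is a factorization of `S` as a product of blocks in which the
cardinalities multiply. -/
lemma isLSFor_iff {G : Type*} [Group G] [DecidableEq G] (S : Finset G) {t : ℕ}
    (B : Fin t → Finset G) :
    IsLSFor S B ↔ (List.ofFn B).prod = S ∧ ((List.ofFn B).map Finset.card).prod = S.card := by
  have hmem (g : G) : g ∈ (List.ofFn B).prod ↔ ∃ b, lsProd B b = g :=
    Finset.mem_prod_list_ofFn
  have himage : Finset.univ.image (lsProd B) = (List.ofFn B).prod := by
    ext g
    simp [hmem]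
  have hprod : ((List.ofFn B).map Finset.card).prod =
      (Finset.univ : Finset (∀ i, (B i : Finset G))).card := by
    simp [List.map_ofFn, List.prod_ofFn]
  have hset : (∀ g : G, g ∈ S ↔ ∃ b, lsProd B b = g) ↔ (List.ofFn B).prod = S := by
    simp only [← hmem, Finset.ext_iff, iff_comm]
  rw [IsLSFor, hset, and_comm]
  refine and_congr_right fun h => ?_
  rw [hprod, ← h, ← himage, eq_comm, Finset.card_image_iff, Finset.coe_univ, Set.injOn_univ]

lemma hasMLSFor_iff {G : Type*} [Group G] [DecidableEq G] (S : Finset G) :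
    HasMLSFor S ↔ ∃ L : List (Finset G), L.prod = S ∧ (L.map Finset.card).prod = S.card ∧
      (L.map Finset.card).sum = lsTarget S.card := by
  have hlength {t : ℕ} (B : Fin t → Finset G) :
      lsLength B = ((List.ofFn B).map Finset.card).sum := by
    simp [lsLength, List.map_ofFn, List.sum_ofFn]
  constructor
  · rintro ⟨t, B, hB, hlen⟩
    obtain ⟨h₁, h₂⟩ := (isLSFor_iff S B).1 hB
    exact ⟨List.ofFn B, h₁, h₂, by rw [← hlength, hlen]⟩
  · rintro ⟨L, h₁, h₂, h₃⟩
    refine ⟨L.length, L.get, (isLSFor_iff S _).2 ?_, ?_⟩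
    · rw [List.ofFn_get]
      exact ⟨h₁, h₂⟩
    · rw [hlength, List.ofFn_get, h₃]

lemma hasMLS_iff_univ {G : Type*} [Group G] [Fintype G] :
    HasMLS G ↔ HasMLSFor (Finset.univ : Finset G) := by
  simp [HasMLS, HasMLSFor, IsLS, IsLSFor, Function.Bijective, Function.Surjective]

lemma HasMLSFor.image {G K : Type*} [Group G] [Group K] [DecidableEq G] [DecidableEq K]
    {S : Finset G} (hS : HasMLSFor S) (f : G →* K) (hf : Function.Injective f) :
    HasMLSFor (S.image f) := by
  obtain ⟨L, h₁, h₂, h₃⟩ := (hasMLSFor_iff S).1 hS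
  have hcard : (L.map (Finset.imageMonoidHom f)).map Finset.card = L.map Finset.card := by
    simp [Function.comp_def, Finset.card_image_of_injective _ hf]
  refine (hasMLSFor_iff _).2 ⟨L.map (Finset.imageMonoidHom f), ?_, ?_, ?_⟩
  · rw [← map_list_prod, h₁]
    rfl
  · rw [hcard, h₂, Finset.card_image_of_injective _ hf]
  · rw [hcard, h₃, Finset.card_image_of_injective _ hf]

lemma hasMLSFor_list_prod {G : Type*} [Group G] [DecidableEq G] {L : List (Finset G)}
    (hL : ∀ S ∈ L, HasMLSFor S) (hne : ∀ S ∈ L, S.card ≠ 0)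
    (hcard : L.prod.card = (L.map Finset.card).prod) : HasMLSFor L.prod := by
  have key : ∃ M : List (Finset G), M.prod = L.prod ∧
      (M.map Finset.card).prod = (L.map Finset.card).prod ∧
      (M.map Finset.card).sum = ((L.map Finset.card).map lsTarget).sum := by
    clear hcard hne
    induction L with
    | nil => exact ⟨[], rfl, rfl, rfl⟩
    | cons S L ih =>
      obtain ⟨M, h₁, h₂, h₃⟩ := ih fun T hT => hL T (by simp [hT])
      obtain ⟨N, k₁, k₂, k₃⟩ := (hasMLSFor_iff S).1 (hL S (by simp))
      refine ⟨N ++ M, ?_, ?_, ?_⟩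
      · rw [List.prod_append, List.prod_cons, k₁, h₁]
      · rw [List.map_append, List.prod_append, List.map_cons, List.prod_cons, k₂, h₂]
      · rw [List.map_append, List.sum_append, List.map_cons, List.map_cons, List.sum_cons, k₃, h₃]
  obtain ⟨M, h₁, h₂, h₃⟩ := key
  refine (hasMLSFor_iff _).2 ⟨M, h₁, by rw [h₂, hcard], ?_⟩
  rw [h₃, hcard, lsTarget_list_prod]
  simpa using hne

/-- if `|G| = |A₁|⋯|Aₙ|·|H|`, `G = A₁⋯Aₙ·H`, each `Aᵢ` admits an MLS
as a subset of `G`, and the subgroup `H` admits an MLS, then `G` admits an MLS. -/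
theorem hasMLS_of_factorization {G : Type*} [Group G] [Finite G] {n : ℕ}
    (A : Fin n → Finset G) (H : Subgroup G)
    (hcard : Nat.card G = (∏ i, (A i).card) * Nat.card H)
    (hsurj : Function.Surjective
      (fun x : (∀ i, (A i : Finset G)) × H => lsProd A x.1 * (x.2 : G)))
    (hA : ∀ i, HasMLSFor (A i)) (hH : HasMLS H) :
    HasMLS G := by
  classical
  have := Fintype.ofFinite G
  set T : Finset G := (Finset.univ : Finset H).image H.subtype with hT
  have hTcard : T.card = Nat.card H := by
    rw [hT, Finset.card_image_of_injective _ H.subtype_injective, Finset.card_univ,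
      Nat.card_eq_fintype_card]
  have hprod : (List.ofFn A ++ [T]).prod = Finset.univ := by
    refine Finset.eq_univ_of_forall fun g => ?_
    obtain ⟨⟨a, h⟩, hg⟩ := hsurj g
    rw [List.prod_append, List.prod_singleton, ← hg]
    exact Finset.mul_mem_mul (Finset.mem_prod_list_ofFn.2 ⟨a, rfl⟩)
      (Finset.mem_image_of_mem _ (Finset.mem_univ h))
  have hcards : ((List.ofFn A ++ [T]).map Finset.card).prod = Nat.card G := by
    rw [hcard, ← hTcard]
    simp [List.map_ofFn, List.prod_ofFn]
  rw [hasMLS_iff_univ, ← hprod]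
  refine hasMLSFor_list_prod (fun S hS => ?_) (fun S hS h0 => ?_) ?_
  · rcases List.mem_append.1 hS with h | h
    · obtain ⟨i, rfl⟩ := List.mem_ofFn.1 h
      exact hA i
    · rw [List.mem_singleton.1 h]
      exact (hasMLS_iff_univ.1 hH).image H.subtype H.subtype_injective
  · refine (Nat.card_pos (α := G)).ne' ?_
    rw [← hcards]
    exact List.prod_eq_zero (h0 ▸ List.mem_map_of_mem hS)
  · rw [hcards, hprod, Finset.card_univ, Nat.card_eq_fintype_card]
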